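/- Let P be a polynomial with complex coefficients of degree n having no zeros in the open unit disk {z : |z| < 1}, let a be a complex number with |a| ≤ 1, and let α, β be complex numbers with |α| ≤ 1 and |β| ≤ 1. Then for every real R ≥ 1 and every complex z with |z| ≥ 1, |S̃_a[P](Rz) − α·S̃_a[P](z) + β(((R+1)/2)^n − |α|)·S̃_a[P](z)| ≤ (1/2)·[ |R^n − α + β(((R+1)/2)^n − |α|)| · n|z|^(n−1) + |1 − α + β(((R+1)/2)^n − |α|)| · n|a| ] · max_{|w|=1} |P(w)|. -/

import Mathlib

open Polynomial

/-- The modified Smirnov operator: S̃ₐ[P](z) = (1+az)·P′(z) − n·a·P(z). -/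
noncomputable def smirnov (n : ℕ) (a : ℂ) (P : Polynomial ℂ) (z : ℂ) : ℂ :=
  (1 + a * z) * P.derivative.eval z - (n : ℂ) * a * P.eval z

/-- The maximum of ‖P‖ on the unit circle. -/
noncomputable def maxCircle (P : Polynomial ℂ) : ℝ :=
  sSup {y : ℝ | ∃ w : ℂ, ‖w‖ = 1 ∧ y = ‖P.eval w‖}

/-- The polynomial whose evaluation is the modified Smirnov operator. -/
noncomputable def smirnovPoly (n : ℕ) (a : ℂ) (P : Polynomial ℂ) : Polynomial ℂ :=
  (1 + C a * X) * derivative P - C ((n : ℂ) * a) * P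

lemma eval_smirnovPoly (n : ℕ) (a : ℂ) (P : Polynomial ℂ) (z : ℂ) :
    (smirnovPoly n a P).eval z = smirnov n a P z := by
  simp [smirnovPoly, smirnov]

/-- The dilated difference of the modified Smirnov operator. -/
noncomputable def smirnovDiff (n : ℕ) (a γ : ℂ) (R : ℝ) (z : ℂ) (P : Polynomial ℂ) : ℂ :=
  smirnov n a P ((R : ℂ) * z) - γ * smirnov n a P z

lemma smirnovDiff_add (n : ℕ) (a γ : ℂ) (R : ℝ) (z : ℂ) (P Q : Polynomial ℂ) :
    smirnovDiff n a γ R z (P + Q) = smirnovDiff n a γ R z P + smirnovDiff n a γ R z Q := by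
  simp only [smirnovDiff, smirnov, derivative_add, eval_add]; ring

lemma smirnovDiff_C_mul (n : ℕ) (a γ : ℂ) (R : ℝ) (z c : ℂ) (P : Polynomial ℂ) :
    smirnovDiff n a γ R z (C c * P) = c * smirnovDiff n a γ R z P := by
  simp only [smirnovDiff, smirnov, derivative_C_mul, eval_mul, eval_C]; ring

lemma smirnovDiff_one (n : ℕ) (a γ : ℂ) (R : ℝ) (z : ℂ) :
    smirnovDiff n a γ R z 1 = -((n : ℂ) * a * (1 - γ)) := by
  simp [smirnovDiff, smirnov]; ring

lemma smirnovDiff_X_pow {n : ℕ} (hn : n ≠ 0) (a γ : ℂ) (R : ℝ) (z : ℂ) :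
    smirnovDiff n a γ R z (X ^ n) = (n : ℂ) * z ^ (n - 1) * ((R : ℂ) ^ (n - 1) - γ) := by
  obtain ⟨m, rfl⟩ := Nat.exists_eq_succ_of_ne_zero hn
  simp [smirnovDiff, smirnov]; ring

lemma coeff_smirnovPoly_pred {n : ℕ} (hn : n ≠ 0) (a : ℂ) (H : Polynomial ℂ) :
    (smirnovPoly n a H).coeff (n - 1) = n * H.coeff n - a * H.coeff (n - 1) := by
  obtain ⟨m, rfl⟩ := Nat.exists_eq_succ_of_ne_zero hn
  cases m with
  | zero => simp [smirnovPoly, add_mul, mul_assoc, coeff_derivative]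
  | succ k =>
    simp [smirnovPoly, add_mul, mul_assoc, coeff_derivative, coeff_X_mul]; ring

lemma natDegree_smirnovPoly_le {n : ℕ} (hn : n ≠ 0) (a : ℂ) (H : Polynomial ℂ)
    (hH : H.natDegree ≤ n) : (smirnovPoly n a H).natDegree ≤ n - 1 := by
  rw [natDegree_le_iff_coeff_eq_zero]
  intro N hN
  obtain ⟨k, rfl⟩ : ∃ k, N = k + 1 := ⟨N - 1, by omega⟩
  have h0 : H.coeff (k + 1 + 1) = 0 := coeff_eq_zero_of_natDegree_lt (by omega)
  rcases (show n = k + 1 ∨ n < k + 1 by omega) with h | h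
  · subst h
    simp [smirnovPoly, add_mul, mul_assoc, coeff_derivative, coeff_X_mul, h0]; ring
  · have h1 : H.coeff (k + 1) = 0 := coeff_eq_zero_of_natDegree_lt (by omega)
    simp [smirnovPoly, add_mul, mul_assoc, coeff_derivative, coeff_X_mul, h0, h1]

lemma norm_root_le_one {H : Polynomial ℂ} (h : ∀ w : ℂ, 1 < ‖w‖ → H.eval w ≠ 0) {r : ℂ}
    (hr : r ∈ H.roots) : ‖r‖ ≤ 1 := by
  by_contra! hlt
  exact h r hlt (isRoot_of_mem_roots hr)

lemma coeff_smirnovPoly_pred_ne_zero {n : ℕ} (hn : n ≠ 0) {a : ℂ} (ha : ‖a‖ < 1)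
    {H : Polynomial ℂ} (hH : H.natDegree = n) (h : ∀ w : ℂ, 1 < ‖w‖ → H.eval w ≠ 0) :
    (smirnovPoly n a H).coeff (n - 1) ≠ 0 := by
  have hl : H.leadingCoeff ≠ 0 := by
    rw [Ne, leadingCoeff_eq_zero]; rintro rfl; simp at hH; omega
  have hnext : H.coeff (n - 1) = -H.leadingCoeff * H.roots.sum := by
    rw [← (IsAlgClosed.splits H).nextCoeff_eq_neg_sum_roots_mul_leadingCoeff,
      nextCoeff_of_natDegree_pos (by omega), hH]
  have hcoeff : H.coeff n = H.leadingCoeff := by rw [leadingCoeff, hH]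
  rw [coeff_smirnovPoly_pred hn, hnext, hcoeff]
  have hsum : ‖H.roots.sum‖ ≤ n := by
    refine (norm_multiset_sum_le _).trans ?_
    refine (Multiset.sum_le_card_nsmul _ 1 ?_).trans ?_
    · intro x hx
      obtain ⟨r, hr, rfl⟩ := Multiset.mem_map.1 hx
      exact norm_root_le_one h hr
    · simp [IsAlgClosed.card_roots_eq_natDegree, hH]
  intro h0
  have h1 : H.leadingCoeff * (n + a * H.roots.sum) = 0 := by linear_combination h0
  have h2 : (n : ℂ) = -(a * H.roots.sum) :=
    eq_neg_of_add_eq_zero_left ((mul_eq_zero.1 h1).resolve_left hl)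
  have h3 : (n : ℝ) = ‖a‖ * ‖H.roots.sum‖ := by
    rw [← norm_mul, ← norm_neg, ← h2, Complex.norm_natCast]
  have hn' : (0 : ℝ) < n := by positivity
  nlinarith [norm_nonneg a]

lemma re_mul_conj_pos_of_norm_sub_lt {x c : ℂ} (h : ‖x - c‖ < ‖c‖) :
    0 < (x * starRingEnd ℂ c).re := by
  have h1 : Complex.normSq (x - c) < Complex.normSq c := by
    rw [Complex.normSq_eq_norm_sq, Complex.normSq_eq_norm_sq]; gcongr
  rw [Complex.normSq_sub] at h1
  linarith [Complex.normSq_nonneg x]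

lemma norm_one_sub_conj_mul_sq (w r : ℂ) :
    ‖1 - starRingEnd ℂ w * r‖ ^ 2 = ‖w - r‖ ^ 2 + (‖w‖ ^ 2 - 1) * (‖r‖ ^ 2 - 1) := by
  simp only [← Complex.normSq_eq_norm_sq, Complex.normSq_apply, Complex.sub_re, Complex.sub_im,
    Complex.mul_re, Complex.mul_im, Complex.conj_re, Complex.conj_im, Complex.one_re,
    Complex.one_im]
  ring

/-- If `‖a‖ < 1`, the image of the closed unit disk under `r ↦ (1 + a r) / (w - r)`, for `w`
outside that disk, lies in an open half-plane bounded by a line through the origin. -/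
lemma re_smirnov_term_pos {a w r : ℂ} (ha : ‖a‖ < 1) (hw : 1 < ‖w‖) (hr : ‖r‖ ≤ 1) :
    0 < ((1 + a * r) / (w - r) * (starRingEnd ℂ a + w)).re := by
  have hne : w - r ≠ 0 := by
    rw [sub_ne_zero]; rintro rfl; linarith
  have hk : 0 < Complex.normSq w - 1 := by
    rw [Complex.normSq_eq_norm_sq]; nlinarith
  have hlt : ‖1 + a * w‖ < ‖a + starRingEnd ℂ w‖ := by
    refine lt_of_pow_lt_pow_left₀ 2 (norm_nonneg _) ?_
    have h1 := norm_one_sub_conj_mul_sq (starRingEnd ℂ w) (-a)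
    rw [Complex.conj_conj, RCLike.norm_conj, norm_neg] at h1
    have e1 : 1 - w * -a = 1 + a * w := by ring
    have e2 : starRingEnd ℂ w - -a = a + starRingEnd ℂ w := by ring
    rw [e1, e2] at h1
    have h2 : 0 < (‖w‖ ^ 2 - 1) * (1 - ‖a‖ ^ 2) :=
      mul_pos (by nlinarith) (by nlinarith [norm_nonneg a])
    linarith
  have hle : ‖starRingEnd ℂ w * r - 1‖ ≤ ‖w - r‖ := by
    rw [norm_sub_rev]
    refine le_of_sq_le_sq ?_ (norm_nonneg _)
    have h2 : 0 ≤ (‖w‖ ^ 2 - 1) * (1 - ‖r‖ ^ 2) :=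
      mul_nonneg (by nlinarith) (by nlinarith [norm_nonneg r])
    linarith [norm_one_sub_conj_mul_sq w r]
  have hid : ((Complex.normSq w - 1 : ℝ) : ℂ) * ((1 + a * r) / (w - r)) - (a + starRingEnd ℂ w) =
      (1 + a * w) * ((starRingEnd ℂ w * r - 1) / (w - r)) := by
    push_cast
    rw [← Complex.mul_conj]
    field_simp
    ring
  have hdisk : ‖((Complex.normSq w - 1 : ℝ) : ℂ) * ((1 + a * r) / (w - r)) -
      (a + starRingEnd ℂ w)‖ < ‖a + starRingEnd ℂ w‖ := by
    rw [hid, norm_mul, norm_div]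
    refine (mul_le_of_le_one_right (norm_nonneg _) ?_).trans_lt hlt
    exact (div_le_one (norm_pos_iff.2 hne)).2 hle
  have hpos := re_mul_conj_pos_of_norm_sub_lt hdisk
  rw [mul_assoc, Complex.re_ofReal_mul, map_add, Complex.conj_conj] at hpos
  exact pos_of_mul_pos_right hpos hk.le

lemma smirnov_ne_zero {n : ℕ} (hn : n ≠ 0) {a : ℂ} (ha : ‖a‖ < 1)
    {H : Polynomial ℂ} (hH : H.natDegree = n) (h : ∀ w : ℂ, 1 < ‖w‖ → H.eval w ≠ 0)
    {w : ℂ} (hw : 1 < ‖w‖) : smirnov n a H w ≠ 0 := by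
  have hHw := h w hw
  have hcard : H.roots.card = n := by rw [IsAlgClosed.card_roots_eq_natDegree, hH]
  have hsum : smirnov n a H w =
      H.eval w * (H.roots.map fun r ↦ (1 + a * r) / (w - r)).sum := by
    have hmap : (H.roots.map fun r ↦ (1 + a * r) / (w - r)) =
        H.roots.map fun r ↦ (1 + a * w) * (1 / (w - r)) + (-a) := by
      refine Multiset.map_congr rfl fun r hr ↦ ?_
      have hne : w - r ≠ 0 := by
        rw [sub_ne_zero]; rintro rfl; linarith [norm_root_le_one h hr]
      field_simp
      ring
    rw [hmap, Multiset.sum_map_add, Multiset.sum_map_mul_left, smirnov,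
      (IsAlgClosed.splits H).eval_derivative_eq_eval_mul_sum hHw]
    simp [hcard]
    ring
  have hpos : ∀ s : Multiset ℂ, (∀ r ∈ s, ‖r‖ ≤ 1) → s ≠ 0 →
      0 < ((s.map fun r ↦ (1 + a * r) / (w - r)).sum * (starRingEnd ℂ a + w)).re := by
    intro s
    induction s using Multiset.induction_on with
    | empty => simp
    | cons r s ih =>
      intro hs _
      have h1 := re_smirnov_term_pos ha hw (hs r (by simp))
      rw [Multiset.map_cons, Multiset.sum_cons, add_mul, Complex.add_re]
      by_cases h0 : s = 0
      · subst h0; simpa using h1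
      · exact add_pos h1 (ih (fun x hx ↦ hs x (by simp [hx])) h0)
  have hroots : H.roots ≠ 0 := by
    rintro h0; rw [h0] at hcard; exact hn (by simpa using hcard.symm)
  rw [hsum]
  refine mul_ne_zero hHw fun h0 ↦ ?_
  have := hpos _ (fun r hr ↦ norm_root_le_one h hr) hroots
  simp [h0] at this

lemma mul_norm_sub_le_norm_dilate_sub {R : ℝ} (hR : 1 ≤ R) {w s : ℂ} (h : ‖s‖ ≤ ‖w‖) :
    (R + 1) / 2 * ‖w - s‖ ≤ ‖(R : ℂ) * w - s‖ := by
  have h2 : Complex.normSq s ≤ Complex.normSq w := by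
    rw [Complex.normSq_eq_norm_sq, Complex.normSq_eq_norm_sq]; gcongr
  refine le_of_sq_le_sq ?_ (norm_nonneg _)
  rw [mul_pow, ← Complex.normSq_eq_norm_sq, ← Complex.normSq_eq_norm_sq]
  simp only [Complex.normSq_apply, Complex.sub_re, Complex.sub_im, Complex.mul_re, Complex.mul_im,
    Complex.ofReal_re, Complex.ofReal_im] at h2 ⊢
  nlinarith [mul_nonneg (mul_nonneg (sub_nonneg.2 hR) (by linarith : 0 ≤ R + 1)) (sub_nonneg.2 h2),
    mul_nonneg (sq_nonneg (R - 1)) (sq_nonneg (w.re + s.re)),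
    mul_nonneg (sq_nonneg (R - 1)) (sq_nonneg (w.im + s.im))]

lemma pow_mul_norm_eval_le_norm_eval_dilate {R : ℝ} (hR : 1 ≤ R) {Q : Polynomial ℂ}
    (h : ∀ w : ℂ, 1 < ‖w‖ → Q.eval w ≠ 0) {w : ℂ} (hw : 1 ≤ ‖w‖) :
    ((R + 1) / 2) ^ Q.natDegree * ‖Q.eval w‖ ≤ ‖Q.eval ((R : ℂ) * w)‖ := by
  have key : ∀ s : Multiset ℂ, (∀ r ∈ s, ‖r‖ ≤ 1) →
      ((R + 1) / 2) ^ s.card * ‖(s.map (w - ·)).prod‖ ≤ ‖(s.map ((R : ℂ) * w - ·)).prod‖ := by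
    intro s
    induction s using Multiset.induction_on with
    | empty => simp
    | cons r s ih =>
      intro hs
      have h1 := mul_norm_sub_le_norm_dilate_sub hR ((hs r (by simp)).trans hw)
      have h2 := ih fun x hx ↦ hs x (by simp [hx])
      simp only [Multiset.map_cons, Multiset.prod_cons, Multiset.card_cons, norm_mul]
      calc _ = ((R + 1) / 2 * ‖w - r‖) *
            (((R + 1) / 2) ^ s.card * ‖(s.map (w - ·)).prod‖) := by ring
        _ ≤ _ := by gcongr
  have := key Q.roots fun r hr ↦ norm_root_le_one h hr
  rw [(IsAlgClosed.splits Q).eval_eq_prod_roots, (IsAlgClosed.splits Q).eval_eq_prod_roots,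
    norm_mul, norm_mul, ← IsAlgClosed.card_roots_eq_natDegree]
  nlinarith [norm_nonneg Q.leadingCoeff]

lemma smirnovDiff_ne_zero {n : ℕ} (hn : n ≠ 0) {a γ : ℂ} {R : ℝ} (ha : ‖a‖ < 1) (hR : 1 ≤ R)
    (hγ : ‖γ‖ < ((R + 1) / 2) ^ (n - 1)) {H : Polynomial ℂ} (hH : H.natDegree ≤ n)
    (hc : H.coeff n ≠ 0) (h : ∀ w : ℂ, 1 < ‖w‖ → H.eval w ≠ 0) {z : ℂ} (hz : 1 < ‖z‖) :
    smirnovDiff n a γ R z H ≠ 0 := by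
  have hdeg : H.natDegree = n := le_antisymm hH (le_natDegree_of_ne_zero hc)
  have hQdeg : (smirnovPoly n a H).natDegree = n - 1 :=
    le_antisymm (natDegree_smirnovPoly_le hn a H hH)
      (le_natDegree_of_ne_zero (coeff_smirnovPoly_pred_ne_zero hn ha hdeg h))
  have hle := pow_mul_norm_eval_le_norm_eval_dilate (Q := smirnovPoly n a H) hR
    (fun w hw ↦ by rw [eval_smirnovPoly]; exact smirnov_ne_zero hn ha hdeg h hw) hz.le
  rw [hQdeg, eval_smirnovPoly, eval_smirnovPoly] at hle
  have hpos : 0 < ‖smirnov n a H z‖ := norm_pos_iff.2 (smirnov_ne_zero hn ha hdeg h hz)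
  intro h0
  rw [smirnovDiff, sub_eq_zero] at h0
  rw [h0, norm_mul] at hle
  nlinarith

/-- The operator `smirnovDiff` preserves pointwise domination outside the unit disk. -/
lemma norm_smirnovDiff_le {n : ℕ} (hn : n ≠ 0) {a γ : ℂ} {R : ℝ} (ha : ‖a‖ < 1) (hR : 1 ≤ R)
    (hγ : ‖γ‖ < ((R + 1) / 2) ^ (n - 1)) {F G : Polynomial ℂ} (hF : F.natDegree ≤ n)
    (hG : G.natDegree ≤ n) (hGc : G.coeff n ≠ 0) (hG0 : ∀ w : ℂ, 1 < ‖w‖ → G.eval w ≠ 0)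
    (hc : ‖F.coeff n‖ ≤ ‖G.coeff n‖) (hle : ∀ w : ℂ, 1 < ‖w‖ → ‖F.eval w‖ ≤ ‖G.eval w‖)
    {z : ℂ} (hz : 1 < ‖z‖) :
    ‖smirnovDiff n a γ R z F‖ ≤ ‖smirnovDiff n a γ R z G‖ := by
  have hTG := smirnovDiff_ne_zero hn ha hR hγ hG hGc hG0 hz
  by_contra! hlt
  set l := smirnovDiff n a γ R z F / smirnovDiff n a γ R z G with hl
  have hl1 : 1 < ‖l‖ := by
    rw [hl, norm_div, one_lt_div (norm_pos_iff.2 hTG)]; exact hlt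
  have hne : ∀ x y : ℂ, ‖x‖ ≤ ‖y‖ → y ≠ 0 → x + -l * y ≠ 0 := by
    intro x y hxy hy h0
    have hx : x = l * y := by linear_combination h0
    rw [hx, norm_mul] at hxy
    nlinarith [norm_pos_iff.2 hy]
  refine smirnovDiff_ne_zero hn ha hR hγ (H := F + C (-l) * G) ?_ ?_ ?_ hz ?_
  · exact natDegree_add_le_of_degree_le hF ((natDegree_C_mul_le _ _).trans hG)
  · simpa using hne _ _ hc hGc
  · intro w hw
    simpa using hne _ _ (hle w hw) (hG0 w hw)
  · rw [smirnovDiff_add, smirnovDiff_C_mul, hl]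
    field_simp
    ring

/-- The conjugate-reciprocal polynomial `zⁿ conj(P(1 / conj z))`. -/
noncomputable def conjReflect (n : ℕ) (P : Polynomial ℂ) : Polynomial ℂ :=
  (P.map (starRingEnd ℂ)).reflect n

lemma natDegree_conjReflect_le {n : ℕ} {P : Polynomial ℂ} (hP : P.natDegree ≤ n) :
    (conjReflect n P).natDegree ≤ n := by
  rw [natDegree_le_iff_coeff_eq_zero]
  intro N hN
  rw [conjReflect, coeff_reflect, revAt_eq_self_of_lt hN, coeff_map,
    coeff_eq_zero_of_natDegree_lt (by omega), map_zero]

lemma coeff_conjReflect_self (n : ℕ) (P : Polynomial ℂ) :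
    (conjReflect n P).coeff n = starRingEnd ℂ (P.eval 0) := by
  simp [conjReflect, coeff_zero_eq_eval_zero]

lemma norm_eval_conjReflect {n : ℕ} {P : Polynomial ℂ} (hP : P.natDegree ≤ n) {w : ℂ}
    (hw : w ≠ 0) :
    ‖(conjReflect n P).eval w‖ = ‖w‖ ^ n * ‖P.eval (starRingEnd ℂ w)⁻¹‖ := by
  let : Invertible w⁻¹ := invertibleOfNonzero (inv_ne_zero hw)
  have h := eval₂_reflect_mul_pow (RingHom.id ℂ) w⁻¹ n (P.map (starRingEnd ℂ))
    (natDegree_map_le.trans hP)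
  rw [invOf_eq_inv, inv_inv, ← eval, ← eval, ← conjReflect] at h
  have h2 : (P.map (starRingEnd ℂ)).eval w⁻¹ = starRingEnd ℂ (P.eval (starRingEnd ℂ w)⁻¹) := by
    rw [eval_map, ← eval₂_at_apply, map_inv₀, Complex.conj_conj]
  rw [h2] at h
  have h3 := congrArg norm h
  rw [RCLike.norm_conj, norm_mul, norm_pow, norm_inv] at h3
  have : ‖w‖ ≠ 0 := norm_ne_zero_iff.2 hw
  rw [← h3, inv_pow]
  field_simp

lemma norm_root_ge_one {P : Polynomial ℂ} (h : ∀ w : ℂ, ‖w‖ < 1 → P.eval w ≠ 0) {r : ℂ}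
    (hr : r ∈ P.roots) : 1 ≤ ‖r‖ := by
  by_contra! hlt
  exact h r hlt (isRoot_of_mem_roots hr)

lemma norm_coeff_natDegree_le {P : Polynomial ℂ} (h : ∀ w : ℂ, ‖w‖ < 1 → P.eval w ≠ 0) :
    ‖P.coeff P.natDegree‖ ≤ ‖P.eval 0‖ := by
  have key : ∀ s : Multiset ℂ, (∀ r ∈ s, 1 ≤ ‖r‖) → 1 ≤ ‖s.prod‖ := by
    intro s
    induction s using Multiset.induction_on with
    | empty => simp
    | cons r s ih =>
      intro hs
      rw [Multiset.prod_cons, norm_mul]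
      exact one_le_mul_of_one_le_of_one_le (hs r (by simp)) (ih fun x hx ↦ hs x (by simp [hx]))
  rw [← coeff_zero_eq_eval_zero, (IsAlgClosed.splits P).coeff_zero_eq_leadingCoeff_mul_prod_roots,
    norm_mul, norm_mul, norm_pow, norm_neg, norm_one, one_pow, one_mul, leadingCoeff]
  exact le_mul_of_one_le_right (norm_nonneg _) (key _ fun r hr ↦ norm_root_ge_one h hr)

lemma norm_sub_le_norm_mul_norm_inv_conj_sub {w r : ℂ} (hw : 1 < ‖w‖) (hr : 1 ≤ ‖r‖) :
    ‖w - r‖ ≤ ‖w‖ * ‖(starRingEnd ℂ w)⁻¹ - r‖ := by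
  have hw0 : w ≠ 0 := norm_pos_iff.1 (by linarith)
  have hc0 : starRingEnd ℂ w ≠ 0 := (_root_.map_ne_zero _).2 hw0
  have h1 : ‖w‖ * ‖(starRingEnd ℂ w)⁻¹ - r‖ = ‖1 - starRingEnd ℂ w * r‖ := by
    rw [← RCLike.norm_conj w, ← norm_mul, mul_sub, mul_inv_cancel₀ hc0]
  rw [h1]
  refine le_of_sq_le_sq ?_ (norm_nonneg _)
  have h2 : 0 ≤ (‖w‖ ^ 2 - 1) * (‖r‖ ^ 2 - 1) := mul_nonneg (by nlinarith) (by nlinarith)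
  linarith [norm_one_sub_conj_mul_sq w r]

lemma norm_eval_le_norm_eval_conjReflect {P : Polynomial ℂ}
    (h : ∀ w : ℂ, ‖w‖ < 1 → P.eval w ≠ 0) {w : ℂ} (hw : 1 < ‖w‖) :
    ‖P.eval w‖ ≤ ‖(conjReflect P.natDegree P).eval w‖ := by
  have key : ∀ s : Multiset ℂ, (∀ r ∈ s, 1 ≤ ‖r‖) →
      ‖(s.map (w - ·)).prod‖ ≤ ‖w‖ ^ s.card * ‖(s.map ((starRingEnd ℂ w)⁻¹ - ·)).prod‖ := by
    intro s
    induction s using Multiset.induction_on with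
    | empty => simp
    | cons r s ih =>
      intro hs
      have h1 := norm_sub_le_norm_mul_norm_inv_conj_sub hw (hs r (by simp))
      have h2 := ih fun x hx ↦ hs x (by simp [hx])
      simp only [Multiset.map_cons, Multiset.prod_cons, Multiset.card_cons, norm_mul]
      calc _ ≤ (‖w‖ * ‖(starRingEnd ℂ w)⁻¹ - r‖) *
            (‖w‖ ^ s.card * ‖(s.map ((starRingEnd ℂ w)⁻¹ - ·)).prod‖) := by gcongr
        _ = _ := by ring
  have hk := key P.roots fun r hr ↦ norm_root_ge_one h hr
  rw [norm_eval_conjReflect le_rfl (norm_pos_iff.1 (by linarith)),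
    (IsAlgClosed.splits P).eval_eq_prod_roots, (IsAlgClosed.splits P).eval_eq_prod_roots,
    norm_mul, norm_mul, ← IsAlgClosed.card_roots_eq_natDegree]
  nlinarith [norm_nonneg P.leadingCoeff]

lemma norm_inv_conj_lt_one {w : ℂ} (hw : 1 < ‖w‖) : ‖(starRingEnd ℂ w)⁻¹‖ < 1 := by
  rw [norm_inv, RCLike.norm_conj]
  exact inv_lt_one_of_one_lt₀ hw

lemma norm_smirnovDiff_le_conjReflect {n : ℕ} (hn : n ≠ 0) {a γ : ℂ} {R : ℝ} (ha : ‖a‖ < 1)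
    (hR : 1 ≤ R) (hγ : ‖γ‖ < ((R + 1) / 2) ^ (n - 1)) {P : Polynomial ℂ} (hP : P.natDegree = n)
    (h : ∀ w : ℂ, ‖w‖ < 1 → P.eval w ≠ 0) {z : ℂ} (hz : 1 < ‖z‖) :
    ‖smirnovDiff n a γ R z P‖ ≤ ‖smirnovDiff n a γ R z (conjReflect n P)‖ := by
  refine norm_smirnovDiff_le hn ha hR hγ hP.le (natDegree_conjReflect_le hP.le) ?_ ?_ ?_ ?_ hz
  · rw [coeff_conjReflect_self]
    exact (_root_.map_ne_zero _).2 (h 0 (by simp))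
  · intro w hw
    have hw0 : w ≠ 0 := norm_pos_iff.1 (by linarith)
    rw [← norm_pos_iff, norm_eval_conjReflect hP.le hw0]
    have := norm_pos_iff.2 (h _ (norm_inv_conj_lt_one hw))
    positivity
  · rw [coeff_conjReflect_self, RCLike.norm_conj, ← hP]
    exact norm_coeff_natDegree_le h
  · intro w hw
    rw [← hP]
    exact norm_eval_le_norm_eval_conjReflect h hw

lemma norm_eval_le_maxCircle (P : Polynomial ℂ) {w : ℂ} (hw : ‖w‖ ≤ 1) :
    ‖P.eval w‖ ≤ maxCircle P := by
  have hbdd : BddAbove {y : ℝ | ∃ w : ℂ, ‖w‖ = 1 ∧ y = ‖P.eval w‖} := by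
    have hc := (isCompact_sphere (0 : ℂ) 1).image (f := fun w ↦ ‖P.eval w‖) (by fun_prop)
    refine hc.bddAbove.mono ?_
    rintro y ⟨w, hw, rfl⟩
    exact ⟨w, by simpa using hw, rfl⟩
  refine Complex.norm_le_of_forall_mem_frontier_norm_le (U := Metric.ball 0 1)
    (f := fun w ↦ P.eval w) Metric.isBounded_ball P.differentiable.diffContOnCl ?_ ?_
  · intro x hx
    rw [frontier_ball _ one_ne_zero] at hx
    exact le_csSup hbdd ⟨x, by simpa using hx, rfl⟩
  · rw [closure_ball _ one_ne_zero]
    simpa using hw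

lemma norm_smirnovDiff_conjReflect_le {n : ℕ} (hn : n ≠ 0) {a γ : ℂ} {R : ℝ} (ha : ‖a‖ < 1)
    (hR : 1 ≤ R) (hγ : ‖γ‖ < ((R + 1) / 2) ^ (n - 1)) {P : Polynomial ℂ} (hP : P.natDegree = n)
    (hM : 0 < maxCircle P) {z : ℂ} (hz : 1 < ‖z‖) :
    ‖smirnovDiff n a γ R z (conjReflect n P)‖ ≤
      maxCircle P * ‖smirnovDiff n a γ R z (X ^ n)‖ := by
  have hMn : ‖(maxCircle P : ℂ)‖ = maxCircle P := by simp [hM.le]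
  have := norm_smirnovDiff_le hn ha hR hγ (F := conjReflect n P)
    (G := C (maxCircle P : ℂ) * X ^ n) (natDegree_conjReflect_le hP.le)
    (natDegree_C_mul_X_pow_le _ _) (by simpa using hM.ne') ?_ ?_ ?_ hz
  · rwa [smirnovDiff_C_mul, norm_mul, hMn] at this
  · intro w hw
    have hw0 : w ≠ 0 := norm_pos_iff.1 (by linarith)
    simp [hw0, hM.ne']
  · rw [coeff_conjReflect_self, RCLike.norm_conj, coeff_C_mul_X_pow, if_pos rfl, hMn]
    exact norm_eval_le_maxCircle P (by simp)
  · intro w hw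
    have hw0 : w ≠ 0 := norm_pos_iff.1 (by linarith)
    rw [norm_eval_conjReflect hP.le hw0, eval_mul, eval_C, eval_pow, eval_X, norm_mul, norm_pow,
      hMn, mul_comm]
    gcongr
    exact norm_eval_le_maxCircle P (norm_inv_conj_lt_one hw).le

lemma exists_norm_eq_norm_add_mul (u v : ℂ) (hle : ‖u‖ ≤ ‖v‖) :
    ∃ c : ℂ, ‖c‖ = 1 ∧ ‖u + c * v‖ = ‖v‖ - ‖u‖ := by
  rcases eq_or_ne u 0 with rfl | hu
  · exact ⟨1, by simp⟩
  have hu' : ‖u‖ ≠ 0 := norm_ne_zero_iff.2 hu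
  have hv : v ≠ 0 := norm_pos_iff.1 ((norm_pos_iff.2 hu).trans_le hle)
  have hv' : ‖v‖ ≠ 0 := norm_ne_zero_iff.2 hv
  refine ⟨-(u / ‖u‖ * (‖v‖ / v)), ?_, ?_⟩
  · simp [hu', hv']
  · have h1 : u + -(u / ‖u‖ * (‖v‖ / v)) * v = -(u / ‖u‖ * ((‖v‖ - ‖u‖ : ℝ) : ℂ)) := by
      have : (‖u‖ : ℂ) ≠ 0 := by exact_mod_cast hu'
      push_cast
      field_simp
      ring
    rw [h1, norm_neg, norm_mul, Complex.norm_real, Real.norm_of_nonneg (sub_nonneg.2 hle)]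
    simp [hu']

lemma two_mul_norm_smirnovDiff_le_of_strict {n : ℕ} (hn : n ≠ 0) {a γ : ℂ} {R : ℝ}
    (ha : ‖a‖ < 1) (hR : 1 ≤ R) (hγ : ‖γ‖ < ((R + 1) / 2) ^ (n - 1)) {P : Polynomial ℂ}
    (hP : P.natDegree = n) (h : ∀ w : ℂ, ‖w‖ < 1 → P.eval w ≠ 0) {z : ℂ} (hz : 1 < ‖z‖) :
    2 * ‖smirnovDiff n a γ R z P‖ ≤
      maxCircle P * (‖smirnovDiff n a γ R z (X ^ n)‖ + ‖smirnovDiff n a γ R z 1‖) := by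
  have hM : 0 < maxCircle P :=
    (norm_pos_iff.2 (h 0 (by simp))).trans_le (norm_eval_le_maxCircle P (by simp))
  have hstar := norm_smirnovDiff_le_conjReflect hn ha hR hγ hP h hz
  suffices hs : ∀ s : ℝ, 1 < s → 2 * ‖smirnovDiff n a γ R z P‖ ≤
      maxCircle P * (‖smirnovDiff n a γ R z (X ^ n)‖ + ‖smirnovDiff n a γ R z 1‖) * s by
    refine ge_of_tendsto (x := nhdsWithin (1 : ℝ) (Set.Ioi 1)) (f := fun s : ℝ ↦ maxCircle P *
      (‖smirnovDiff n a γ R z (X ^ n)‖ + ‖smirnovDiff n a γ R z 1‖) * s) ?_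
      (Filter.eventually_of_mem self_mem_nhdsWithin hs)
    refine tendsto_nhdsWithin_of_tendsto_nhds ?_
    convert! (continuous_const_mul (maxCircle P * (‖smirnovDiff n a γ R z (X ^ n)‖ +
      ‖smirnovDiff n a γ R z 1‖))).tendsto (1 : ℝ) using 2
    ring
  intro s hs
  have hub := norm_smirnovDiff_conjReflect_le hn ha hR hγ hP hM hz
  set k : ℂ := ((s * maxCircle P : ℝ) : ℂ) with hk
  have hkn : ‖k‖ = s * maxCircle P := by
    rw [hk, Complex.norm_real, Real.norm_of_nonneg (by positivity)]
  obtain ⟨c, hc, hce⟩ := exists_norm_eq_norm_add_mul (smirnovDiff n a γ R z (conjReflect n P))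
    (k * smirnovDiff n a γ R z (X ^ n)) (by
      rw [norm_mul, hkn]
      refine hub.trans ?_
      rw [mul_assoc]
      exact le_mul_of_one_le_left (by positivity) hs.le)
  set e : ℂ := starRingEnd ℂ (c * k) with he
  have hen : ‖e‖ = s * maxCircle P := by rw [he, RCLike.norm_conj, norm_mul, hc, one_mul, hkn]
  have hdeg : (P + C e).natDegree = n := by rw [natDegree_add_C, hP]
  have hfree : ∀ w : ℂ, ‖w‖ < 1 → (P + C e).eval w ≠ 0 := by
    intro w hw h0
    have h1 : P.eval w = -e := by
      rw [eval_add, eval_C] at h0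
      exact eq_neg_of_add_eq_zero_left h0
    have h2 := norm_eval_le_maxCircle P hw.le
    rw [h1, norm_neg, hen] at h2
    nlinarith
  have hcr : conjReflect n (P + C e) = conjReflect n P + C (c * k) * X ^ n := by
    rw [conjReflect, Polynomial.map_add, reflect_add, map_C, reflect_C, he, Complex.conj_conj,
      conjReflect]
  have hfin := norm_smirnovDiff_le_conjReflect hn ha hR hγ hdeg hfree hz
  rw [hcr, smirnovDiff_add, smirnovDiff_add, smirnovDiff_C_mul, mul_assoc c k, hce,
    ← mul_one (C e), smirnovDiff_C_mul, norm_mul, hkn] at hfin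
  have htri : ‖smirnovDiff n a γ R z P‖ ≤
      ‖smirnovDiff n a γ R z P + e * smirnovDiff n a γ R z 1‖ +
        ‖e * smirnovDiff n a γ R z 1‖ := by
    simpa using norm_sub_le (smirnovDiff n a γ R z P + e * smirnovDiff n a γ R z 1)
      (e * smirnovDiff n a γ R z 1)
  rw [norm_mul, hen] at htri
  linarith

/-- The Bernstein-type estimate in which the dilation factor enters as `R ^ (n - 1)`. -/
lemma norm_smirnovDiff_le_of_norm_le {n : ℕ} (hn : n ≠ 0) {a γ : ℂ} {R : ℝ} (ha : ‖a‖ ≤ 1)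
    (hR : 1 ≤ R) (hγ : ‖γ‖ ≤ ((R + 1) / 2) ^ (n - 1)) {P : Polynomial ℂ} (hP : P.natDegree = n)
    (h : ∀ w : ℂ, ‖w‖ < 1 → P.eval w ≠ 0) {z : ℂ} (hz : 1 ≤ ‖z‖) :
    2 * ‖smirnovDiff n a γ R z P‖ ≤ maxCircle P *
      (n * ‖z‖ ^ (n - 1) * ‖(R : ℂ) ^ (n - 1) - γ‖ + n * ‖a‖ * ‖1 - γ‖) := by
  have hclosed : IsClosed {s : ℝ | 2 * ‖smirnovDiff n (s * a) (s * γ) R ((2 - s : ℝ) * z) P‖ ≤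
      maxCircle P * (n * ‖((2 - s : ℝ) : ℂ) * z‖ ^ (n - 1) * ‖(R : ℂ) ^ (n - 1) - s * γ‖ +
        n * ‖(s : ℂ) * a‖ * ‖1 - s * γ‖)} := by
    unfold smirnovDiff smirnov
    exact isClosed_le (by fun_prop) (by fun_prop)
  have hmem : (1 : ℝ) ∈ closure (Set.Ioo (0 : ℝ) 1) := by
    rw [closure_Ioo zero_ne_one]; simp
  have hsub := closure_minimal (s := Set.Ioo (0 : ℝ) 1) ?_ hclosed
  · have := hsub hmem
    norm_num at this
    exact this
  · rintro s ⟨hs0, hs1⟩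
    have hns : ‖(s : ℂ)‖ = s := by simp [hs0.le]
    have hnt : ‖((2 - s : ℝ) : ℂ)‖ = 2 - s := by
      rw [Complex.norm_real, Real.norm_of_nonneg (by linarith)]
    have hρ : 0 < ((R + 1) / 2) ^ (n - 1) := by positivity
    have hmain := two_mul_norm_smirnovDiff_le_of_strict hn (a := s * a) (γ := s * γ)
      (z := ((2 - s : ℝ) : ℂ) * z)
      (by rw [norm_mul, hns]; nlinarith [norm_nonneg a]) hR
      (by rw [norm_mul, hns]; nlinarith [norm_nonneg γ]) hP h
      (by rw [norm_mul, hnt]; nlinarith)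
    rw [smirnovDiff_X_pow hn, smirnovDiff_one, norm_neg, norm_mul, norm_mul, norm_pow, norm_mul,
      norm_mul, Complex.norm_natCast] at hmain
    simpa only [Set.mem_ofPred_eq, norm_mul, Complex.norm_natCast] using hmain

lemma norm_sub_one_le_norm_sub {γ : ℂ} {x : ℝ} (hx : 1 ≤ x) (hγ : ‖γ‖ ≤ (x + 1) / 2) :
    ‖1 - γ‖ ≤ ‖(x : ℂ) - γ‖ := by
  refine le_of_sq_le_sq ?_ (norm_nonneg _)
  rw [← Complex.normSq_eq_norm_sq, ← Complex.normSq_eq_norm_sq]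
  have := (Complex.re_le_norm γ).trans hγ
  simp only [Complex.normSq_apply, Complex.sub_re, Complex.sub_im, Complex.one_re, Complex.one_im,
    Complex.ofReal_re, Complex.ofReal_im]
  nlinarith

lemma pow_half_le (n : ℕ) {R : ℝ} (hR : 1 ≤ R) : ((R + 1) / 2) ^ n ≤ (R ^ n + 1) / 2 := by
  have := (convexOn_pow (𝕜 := ℝ) n).2 (Set.mem_Ici.2 (zero_le_one.trans hR))
    (Set.mem_Ici.2 zero_le_one) (by norm_num : (0 : ℝ) ≤ 1 / 2) (by norm_num : (0 : ℝ) ≤ 1 / 2)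
    (by norm_num)
  simp only [smul_eq_mul, one_pow] at this
  calc _ = (1 / 2 * R + 1 / 2 * 1) ^ n := by ring
    _ ≤ _ := this
    _ = _ := by ring

lemma pow_sub_one_mul_pow_sub_one_le (m : ℕ) {x y : ℝ} (hx : 1 ≤ x) (hxy : x ≤ y) :
    (y ^ m - 1) * (x ^ (m + 1) - 1) ≤ (x ^ m - 1) * (y ^ (m + 1) - 1) := by
  have hsum : (∑ i ∈ Finset.range m, y ^ i) * x ^ m ≤ (∑ i ∈ Finset.range m, x ^ i) * y ^ m := by
    rw [Finset.sum_mul, Finset.sum_mul]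
    refine Finset.sum_le_sum fun i hi ↦ ?_
    have hx0 : 0 ≤ x := by linarith
    have hy0 : 0 ≤ y := by linarith
    obtain ⟨k, rfl⟩ := Nat.exists_eq_add_of_le (Finset.mem_range.1 hi).le
    calc y ^ i * x ^ (i + k) = x ^ i * y ^ i * x ^ k := by ring
      _ ≤ x ^ i * y ^ i * y ^ k := by gcongr
      _ = _ := by ring
  rw [← geom_sum_mul, ← geom_sum_mul, ← geom_sum_mul, ← geom_sum_mul, Finset.sum_range_succ,
    Finset.sum_range_succ]
  have hxy' : 0 ≤ (x - 1) * (y - 1) := mul_nonneg (by linarith) (by linarith)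
  linear_combination (x - 1) * (y - 1) * hsum

lemma smirnovDiff_eq_add (n : ℕ) (a γ δ : ℂ) (R : ℝ) (z : ℂ) (P : Polynomial ℂ) :
    smirnovDiff n a γ R z P =
      smirnovDiff n a δ R z P + (δ - γ) * smirnovDiff n a 0 1 z P := by
  simp [smirnovDiff]; ring

lemma two_mul_norm_smirnovDiff_le {n : ℕ} (hn : n ≠ 0) {a γ : ℂ} {R : ℝ} (ha : ‖a‖ ≤ 1)
    (hR : 1 ≤ R) (hγ : ‖γ‖ ≤ ((R + 1) / 2) ^ n) {P : Polynomial ℂ} (hP : P.natDegree = n)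
    (h : ∀ w : ℂ, ‖w‖ < 1 → P.eval w ≠ 0) {z : ℂ} (hz : 1 ≤ ‖z‖) :
    2 * ‖smirnovDiff n a γ R z P‖ ≤ maxCircle P *
      (n * ‖z‖ ^ (n - 1) * ‖(R : ℂ) ^ n - γ‖ + n * ‖a‖ * ‖1 - γ‖) := by
  have hM : 0 ≤ maxCircle P := (norm_nonneg _).trans (norm_eval_le_maxCircle P (w := 0) (by simp))
  have hY := norm_smirnovDiff_le_of_norm_le hn ha le_rfl (γ := 0) (by simp) hP h hz
  simp only [Complex.ofReal_one, one_pow, sub_zero, norm_one, mul_one] at hY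
  -- `t` is chosen so that `R ^ (n - 1) = 1 + t * (R ^ n - 1)`.
  obtain ⟨t, ht0, ht1, htR, hδ⟩ : ∃ t : ℝ, 0 ≤ t ∧ t ≤ 1 ∧ R ^ (n - 1) = 1 + t * (R ^ n - 1) ∧
      ‖1 + (t : ℂ) * (γ - 1)‖ ≤ ((R + 1) / 2) ^ (n - 1) := by
    rcases hR.eq_or_lt with rfl | hR1
    · exact ⟨0, by simp⟩
    have hRn : 1 < R ^ n := one_lt_pow₀ hR1 hn
    have hRm : 1 ≤ R ^ (n - 1) := one_le_pow₀ hR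
    have hRmn : R ^ (n - 1) ≤ R ^ n := pow_le_pow_right₀ hR (by omega)
    set t := (R ^ (n - 1) - 1) / (R ^ n - 1) with ht
    have hmul : t * (R ^ n - 1) = R ^ (n - 1) - 1 := div_mul_cancel₀ _ (by linarith)
    have ht0 : 0 ≤ t := div_nonneg (by linarith) (by linarith)
    have ht1 : t ≤ 1 := (div_le_one (by linarith)).2 (by linarith)
    refine ⟨t, ht0, ht1, by linarith, ?_⟩
    have hnorm : ‖1 + (t : ℂ) * (γ - 1)‖ ≤ (1 - t) + t * ‖γ‖ := by
      calc _ = ‖((1 - t : ℝ) : ℂ) + (t : ℂ) * γ‖ := by congr 1; push_cast; ring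
        _ ≤ _ := by
          refine (norm_add_le _ _).trans_eq ?_
          rw [norm_mul, Complex.norm_real, Complex.norm_real, Real.norm_of_nonneg ht0,
            Real.norm_of_nonneg (by linarith)]
    have hmono := pow_sub_one_mul_pow_sub_one_le (n - 1) (x := (R + 1) / 2) (y := R)
      (by linarith) (by linarith)
    rw [Nat.sub_add_cancel (by omega), ← hmul] at hmono
    have hkey : t * (((R + 1) / 2) ^ n - 1) ≤ ((R + 1) / 2) ^ (n - 1) - 1 := by
      have : (t * (((R + 1) / 2) ^ n - 1)) * (R ^ n - 1) ≤
          (((R + 1) / 2) ^ (n - 1) - 1) * (R ^ n - 1) := by linarith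
      exact le_of_mul_le_mul_right this (by linarith)
    nlinarith
  set δ : ℂ := 1 + (t : ℂ) * (γ - 1) with hδdef
  have hX := norm_smirnovDiff_le_of_norm_le hn ha hR hδ hP h hz
  have htn : ‖(t : ℂ)‖ = t := by simp [ht0]
  have htn' : ‖((1 - t : ℝ) : ℂ)‖ = 1 - t := by
    rw [Complex.norm_real, Real.norm_of_nonneg (by linarith)]
  have h1 : ‖(R : ℂ) ^ (n - 1) - δ‖ = t * ‖(R : ℂ) ^ n - γ‖ := by
    have : (R : ℂ) ^ (n - 1) = 1 + t * ((R : ℂ) ^ n - 1) := by exact_mod_cast htR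
    rw [this, hδdef, ← congrArg (· * _) htn, ← norm_mul]
    congr 1; ring
  have h2 : ‖1 - δ‖ = t * ‖1 - γ‖ := by
    rw [hδdef, ← congrArg (· * _) htn, ← norm_mul]
    congr 1; ring
  have h3 : ‖δ - γ‖ = (1 - t) * ‖1 - γ‖ := by
    rw [hδdef, ← congrArg (· * _) htn', ← norm_mul]
    congr 1; push_cast; ring
  have h4 : ‖1 - γ‖ ≤ ‖(R : ℂ) ^ n - γ‖ := by
    have := norm_sub_one_le_norm_sub (one_le_pow₀ hR) (hγ.trans (pow_half_le n hR))
    simpa using this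
  rw [h1, h2] at hX
  have htri := norm_add_le (smirnovDiff n a δ R z P) ((δ - γ) * smirnovDiff n a 0 1 z P)
  rw [← smirnovDiff_eq_add, norm_mul, h3] at htri
  have hA : 0 ≤ maxCircle P * (n * ‖z‖ ^ (n - 1)) := by positivity
  have hu : 0 ≤ (1 - t) * ‖1 - γ‖ := mul_nonneg (by linarith) (norm_nonneg _)
  have h5 := mul_le_mul_of_nonneg_left hY hu
  have h6 := mul_le_mul_of_nonneg_left (mul_le_mul_of_nonneg_left h4 (sub_nonneg.2 ht1)) hA
  nlinarith

theorem statement5 (n : ℕ) (P : Polynomial ℂ) (hP : P.natDegree = n)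
    (hP0 : ∀ w : ℂ, ‖w‖ < 1 → P.eval w ≠ 0)
    (a α β : ℂ) (ha : ‖a‖ ≤ 1) (hα : ‖α‖ ≤ 1) (hβ : ‖β‖ ≤ 1)
    (R : ℝ) (hR : 1 ≤ R) (z : ℂ) (hz : 1 ≤ ‖z‖) :
    ‖smirnov n a P ((R : ℂ) * z) - α * smirnov n a P z
        + β * (((((R + 1) / 2) ^ n - ‖α‖ : ℝ)) : ℂ) * smirnov n a P z‖
      ≤ (1 / 2) * (‖(R : ℂ) ^ n - α + β * (((((R + 1) / 2) ^ n - ‖α‖ : ℝ)) : ℂ)‖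
            * ((n : ℝ) * ‖z‖ ^ (n - 1))
          + ‖1 - α + β * (((((R + 1) / 2) ^ n - ‖α‖ : ℝ)) : ℂ)‖ * ((n : ℝ) * ‖a‖))
        * maxCircle P := by
  rcases eq_or_ne n 0 with rfl | hn
  · rw [eq_C_of_natDegree_eq_zero hP]
    simp [smirnov]
  have hk : 0 ≤ ((R + 1) / 2) ^ n - ‖α‖ := by
    have : 1 ≤ ((R + 1) / 2) ^ n := one_le_pow₀ (by linarith)
    linarith
  set k : ℝ := ((R + 1) / 2) ^ n - ‖α‖ with hkdef
  have hγ : ‖α - β * (k : ℂ)‖ ≤ ((R + 1) / 2) ^ n := by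
    refine (norm_sub_le _ _).trans ?_
    rw [norm_mul, Complex.norm_real, Real.norm_of_nonneg hk]
    nlinarith
  have hmain := two_mul_norm_smirnovDiff_le hn ha hR hγ hP hP0 hz
  have e1 : smirnov n a P ((R : ℂ) * z) - α * smirnov n a P z + β * (k : ℂ) * smirnov n a P z =
      smirnovDiff n a (α - β * (k : ℂ)) R z P := by
    rw [smirnovDiff]; ring
  rw [e1, sub_add, sub_add]
  linarith
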